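/- Let a, b_1, …, b_s : ℤ^d → ℂ be finitely supported. Then the frequency-domain condition — for all ξ ∈ ℝ^d and all ω ∈ {0,1}^d: â(ξ)·conj(â(ξ+πω)) + Σ_{ℓ=1}^s b̂_ℓ(ξ)·conj(b̂_ℓ(ξ+πω)) = δ(ω) — holds if and only if the spatial-domain condition holds: for all γ ∈ {0,1}^d and all n ∈ ℤ^d, Σ_{k∈ℤ^d} a(γ+2k)·conj(a(n+γ+2k)) + Σ_{ℓ=1}^s Σ_{k∈ℤ^d} b_ℓ(γ+2k)·conj(b_ℓ(n+γ+2k)) = 2^{-d}·δ(n). -/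

import Mathlib

open scoped BigOperators

/-- The Fourier series `â(ξ) = Σ_{k ∈ ℤ^d} a(k) e^{-i k·ξ}` of a (finitely supported)
filter `a : ℤ^d → ℂ`. -/
noncomputable def fourierSeries {d : ℕ} (a : (Fin d → ℤ) → ℂ) (ξ : Fin d → ℝ) : ℂ :=
  ∑ᶠ k : Fin d → ℤ, a k * Complex.exp (-Complex.I * ∑ i, (k i : ℂ) * (ξ i : ℂ))

/-- The exponential `ξ ↦ e^{i n·ξ}` as a character of the additive group `ℝ^d`. -/
noncomputable def expChar {d : ℕ} (n : Fin d → ℤ) : Multiplicative (Fin d → ℝ) →* ℂ where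
  toFun ξ := Complex.exp (Complex.I * ∑ i, (n i : ℂ) * (ξ.toAdd i : ℂ))
  map_one' := by simp
  map_mul' ξ η := by
    rw [← Complex.exp_add, ← mul_add, ← Finset.sum_add_distrib]
    simp [mul_add]

theorem expChar_apply {d : ℕ} (n : Fin d → ℤ) (ξ : Fin d → ℝ) :
    expChar n (.ofAdd ξ) = Complex.exp (Complex.I * ∑ i, (n i : ℂ) * (ξ i : ℂ)) := rfl

theorem expChar_injective {d : ℕ} : Function.Injective (expChar (d := d)) := by
  intro n m h
  by_contra hne
  obtain ⟨j, hj⟩ := Function.ne_iff.mp hne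
  have hsub : ((n j : ℂ) - m j) ≠ 0 := sub_ne_zero.mpr (by exact_mod_cast hj)
  have hval := DFunLike.congr_fun h
    (.ofAdd (Pi.single j (Real.pi / ((n j : ℝ) - m j)) : Fin d → ℝ))
  have hsum (p : Fin d → ℤ) (t : ℝ) :
      ∑ i, (p i : ℂ) * ((Pi.single j t : Fin d → ℝ) i : ℂ) = p j * t := by
    rw [Finset.sum_eq_single j] <;> simp +contextual
  rw [expChar_apply, expChar_apply, hsum, hsum] at hval
  have hquot := (div_eq_one_iff_eq (Complex.exp_ne_zero _)).mpr hval
  rw [← Complex.exp_sub] at hquot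
  have harg : Complex.I * ((n j : ℂ) * ((Real.pi / ((n j : ℝ) - m j) : ℝ) : ℂ)) -
      Complex.I * ((m j : ℂ) * ((Real.pi / ((n j : ℝ) - m j) : ℝ) : ℂ)) =
      Real.pi * Complex.I := by
    push_cast
    field_simp
  rw [harg, Complex.exp_pi_mul_I] at hquot
  norm_num at hquot

/-- A trigonometric polynomial vanishes identically only if its coefficients vanish. -/
theorem trigPolynomial_eq_zero {d : ℕ} (N : Finset (Fin d → ℤ)) (c : (Fin d → ℤ) → ℂ)
    (h : ∀ ξ : Fin d → ℝ, ∑ n ∈ N, c n * expChar n (.ofAdd ξ) = 0) : ∀ n ∈ N, c n = 0 := by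
  have hli := (linearIndependent_monoidHom (Multiplicative (Fin d → ℝ)) ℂ).comp _
    (expChar_injective (d := d))
  refine linearIndependent_iff'.mp hli N c ?_
  funext ξ
  simpa [Finset.sum_apply] using h ξ.toAdd

/-- The sign `(-1)^{m·ω}`. -/
noncomputable def paritySign {d : ℕ} (m ω : Fin d → ℤ) : ℂ := ∏ i, (-1 : ℂ) ^ (m i * ω i)

theorem paritySign_comm {d : ℕ} (m ω : Fin d → ℤ) : paritySign m ω = paritySign ω m := by
  simp [paritySign, mul_comm]

theorem paritySign_zero_right {d : ℕ} (m : Fin d → ℤ) : paritySign m 0 = 1 := by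
  simp [paritySign]

theorem paritySign_mul {d : ℕ} (m m' ω : Fin d → ℤ) :
    paritySign m ω * paritySign m' ω = paritySign (m + m') ω := by
  simp [paritySign, ← Finset.prod_mul_distrib, ← zpow_add₀, add_mul]

/-- The representatives `{0,1}^d` of `ℤ^d / 2ℤ^d`. -/
def binaryCube (d : ℕ) : Finset (Fin d → ℤ) := Fintype.piFinset fun _ => {0, 1}

theorem mem_binaryCube {d : ℕ} {ω : Fin d → ℤ} :
    ω ∈ binaryCube d ↔ ∀ i, ω i = 0 ∨ ω i = 1 := by
  simp [binaryCube]

theorem sum_paritySign {d : ℕ} (m : Fin d → ℤ) :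
    ∑ ω ∈ binaryCube d, paritySign m ω = if ∀ i, Even (m i) then (2 : ℂ) ^ d else 0 := by
  unfold paritySign binaryCube
  rw [← Finset.prod_univ_sum (fun _ => ({0, 1} : Finset ℤ)) fun i x => (-1 : ℂ) ^ (m i * x)]
  split_ifs with h
  · rw [Finset.prod_congr rfl fun i _ => show
      ∑ x ∈ ({0, 1} : Finset ℤ), (-1 : ℂ) ^ (m i * x) = 2 by
        simp [(h i).neg_one_zpow]; norm_num]
    simp
  · push Not at h
    obtain ⟨i, hi⟩ := h
    refine Finset.prod_eq_zero (Finset.mem_univ i) ?_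
    simp [(Int.not_even_iff_odd.mp hi).neg_one_zpow]

theorem fourierSeries_eq_sum {d : ℕ} {a : (Fin d → ℤ) → ℂ} {T : Finset (Fin d → ℤ)}
    (hT : Function.support a ⊆ T) (ξ : Fin d → ℝ) :
    fourierSeries a ξ =
      ∑ k ∈ T, a k * Complex.exp (-Complex.I * ∑ i, (k i : ℂ) * (ξ i : ℂ)) :=
  finsum_eq_sum_of_support_subset _ ((Function.support_mul_subset_left _ _).trans hT)

theorem conj_exp_shift {d : ℕ} (m ω : Fin d → ℤ) (ξ : Fin d → ℝ) :
    (starRingEnd ℂ) (Complex.exp (-Complex.I *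
      ∑ i, (m i : ℂ) * ((ξ i + Real.pi * (ω i : ℝ) : ℝ) : ℂ))) =
    paritySign m ω * expChar m (.ofAdd ξ) := by
  have hsign : paritySign m ω =
      Complex.exp (Complex.I * ∑ i, (m i : ℂ) * (Real.pi * (ω i : ℂ))) := by
    rw [Finset.mul_sum, Complex.exp_sum]
    refine Finset.prod_congr rfl fun i _ => ?_
    rw [← Complex.exp_pi_mul_I, ← Complex.exp_int_mul]
    push_cast
    ring_nf
  rw [hsign, expChar_apply, ← Complex.exp_add, ← mul_add, ← Finset.sum_add_distrib,
    ← Complex.exp_conj]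
  simp [mul_add, add_comm]

/-- The part of the correlation of `c` with its translate by `n` carried by `γ + 2ℤ^d`. -/
noncomputable def cosetCorrelation {d : ℕ} (c : (Fin d → ℤ) → ℂ) (n γ : Fin d → ℤ) : ℂ :=
  ∑ᶠ k : Fin d → ℤ, c (fun i => γ i + 2 * k i) *
    (starRingEnd ℂ) (c (fun i => n i + γ i + 2 * k i))

theorem sum_eq_sum_binaryCube_finsum {d : ℕ} {g : (Fin d → ℤ) → ℂ} {T : Finset (Fin d → ℤ)}
    (hT : Function.support g ⊆ T) :
    ∑ k ∈ T, g k = ∑ γ ∈ binaryCube d, ∑ᶠ k : Fin d → ℤ, g (fun i => γ i + 2 * k i) := by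
  rw [← Finset.sum_fiberwise_of_maps_to (t := binaryCube d) (g := fun k i => k i % 2)
    fun k _ => mem_binaryCube.mpr fun i => Int.emod_two_eq_zero_or_one _]
  refine Finset.sum_congr rfl fun γ hγ => ?_
  have hinj : Function.Injective fun (k : Fin d → ℤ) i => γ i + 2 * k i := by
    intro k l hkl
    funext i
    have := congrFun hkl i
    dsimp only at this
    omega
  rw [← finsum_mem_range (f := g) hinj]
  symm
  refine finsum_mem_eq_sum_of_inter_support_eq _ ?_
  ext k
  simp only [Set.mem_inter_iff, Set.mem_range, Finset.coe_filter, Set.mem_ofPred_eq]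
  refine and_congr_left fun hk => ⟨?_, ?_⟩
  · rintro ⟨l, rfl⟩
    refine ⟨hT hk, funext fun i => ?_⟩
    rcases mem_binaryCube.mp hγ i with h | h <;> dsimp only <;> omega
  · rintro ⟨-, h⟩
    refine ⟨fun i => k i / 2, funext fun i => ?_⟩
    have := congrFun h i
    dsimp only at this ⊢
    omega

theorem paritySign_add_two_mul {d : ℕ} (n γ k ω : Fin d → ℤ) :
    paritySign (n + fun i => γ i + 2 * k i) ω = paritySign (n + γ) ω := by
  refine Finset.prod_congr rfl fun i _ => ?_
  have : (n + fun i => γ i + 2 * k i) i * ω i = (n + γ) i * ω i + 2 * (k i * ω i) := by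
    simp only [Pi.add_apply]
    ring
  rw [this, zpow_add₀ (by norm_num), (even_two_mul _).neg_one_zpow, mul_one]

/-- The coefficients of `ĉ(ξ) conj(ĉ(ξ + πω))` as a trigonometric polynomial in `ξ`. -/
theorem fourierSeries_mul_conj_shift {d : ℕ} {c : (Fin d → ℤ) → ℂ}
    {T N : Finset (Fin d → ℤ)} (hT : Function.support c ⊆ T)
    (hN : ∀ k ∈ T, ∀ m ∈ T, m - k ∈ N) (ξ : Fin d → ℝ) (ω : Fin d → ℤ) :
    fourierSeries c ξ *
      (starRingEnd ℂ) (fourierSeries c (fun i => ξ i + Real.pi * (ω i : ℝ))) =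
    ∑ n ∈ N, (∑ γ ∈ binaryCube d, paritySign (n + γ) ω * cosetCorrelation c n γ) *
      expChar n (.ofAdd ξ) := by
  have hcoeff (n : Fin d → ℤ) :
      ∑ γ ∈ binaryCube d, paritySign (n + γ) ω * cosetCorrelation c n γ =
      ∑ k ∈ T, c k * (starRingEnd ℂ) (c (n + k)) * paritySign (n + k) ω := by
    rw [sum_eq_sum_binaryCube_finsum
      (g := fun k => c k * (starRingEnd ℂ) (c (n + k)) * paritySign (n + k) ω)]
    · refine Finset.sum_congr rfl fun γ _ => ?_
      simp only [paritySign_add_two_mul, cosetCorrelation]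
      rw [← smul_eq_mul, smul_finsum]
      refine finsum_congr fun k => ?_
      rw [smul_eq_mul, mul_comm]
      congr 4
      funext i
      simp [add_assoc]
    · intro k hk
      exact hT fun h => hk (by simp [h])
  simp only [hcoeff]
  rw [fourierSeries_eq_sum hT, fourierSeries_eq_sum hT, map_sum, Finset.sum_mul_sum]
  simp only [Finset.sum_mul]
  rw [Finset.sum_comm (s := N)]
  refine Finset.sum_congr rfl fun k hk => ?_
  have hreindex (f : (Fin d → ℤ) → ℂ) (hf : Function.support f ⊆ T) :
      ∑ m ∈ T, f m = ∑ n ∈ N, f (n + k) := by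
    rw [← finsum_eq_sum_of_support_subset f hf, ← finsum_comp_equiv (Equiv.addRight k)]
    refine finsum_eq_sum_of_support_subset _ fun n hn => ?_
    simpa using hN k hk (n + k) (hf hn)
  rw [hreindex]
  · refine Finset.sum_congr rfl fun n _ => ?_
    rw [map_mul, conj_exp_shift]
    have hexp : Complex.exp (-Complex.I * ∑ i, (k i : ℂ) * (ξ i : ℂ)) *
        expChar (n + k) (.ofAdd ξ) = expChar n (.ofAdd ξ) := by
      rw [expChar_apply, expChar_apply, ← Complex.exp_add]
      congr 1
      simp only [Pi.add_apply, Int.cast_add, add_mul, Finset.sum_add_distrib]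
      ring
    rw [← hexp]
    ring_nf
  · intro m hm
    exact hT fun h => hm (by simp [h])

theorem even_add_iff_of_mem_binaryCube {d : ℕ} {γ γ' : Fin d → ℤ} (n : Fin d → ℤ)
    (hγ : γ ∈ binaryCube d) (hγ' : γ' ∈ binaryCube d) :
    (∀ i, Even ((n + γ' + (n + γ)) i)) ↔ γ = γ' := by
  rw [funext_iff]
  refine forall_congr' fun i => ?_
  have h := mem_binaryCube.mp hγ i
  have h' := mem_binaryCube.mp hγ' i
  simp only [Pi.add_apply, Int.even_iff]
  omega

/-- Fourier inversion on `ℤ^d / 2ℤ^d`. -/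
theorem paritySign_transform_eq_iff {d : ℕ} (n : Fin d → ℤ) (G : (Fin d → ℤ) → ℂ) :
    (∀ ω ∈ binaryCube d, ∑ γ ∈ binaryCube d, paritySign (n + γ) ω * G γ =
      (if ω = 0 then 1 else 0) * (if n = 0 then 1 else 0)) ↔
    ∀ γ ∈ binaryCube d, G γ = ((2 : ℂ) ^ d)⁻¹ * (if n = 0 then 1 else 0) := by
  have hzero : (0 : Fin d → ℤ) ∈ binaryCube d := mem_binaryCube.mpr fun _ => Or.inl rfl
  constructor
  · intro h γ' hγ'
    have hleft : ∑ ω ∈ binaryCube d, paritySign (n + γ') ω *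
        ∑ γ ∈ binaryCube d, paritySign (n + γ) ω * G γ = (2 : ℂ) ^ d * G γ' := by
      simp only [Finset.mul_sum]
      rw [Finset.sum_comm]
      simp only [← mul_assoc, paritySign_mul, ← Finset.sum_mul, sum_paritySign]
      rw [Finset.sum_eq_single_of_mem γ' hγ']
      · rw [if_pos ((even_add_iff_of_mem_binaryCube n hγ' hγ').mpr rfl)]
      · intro γ hγ hne
        rw [if_neg (mt (even_add_iff_of_mem_binaryCube n hγ hγ').mp hne), zero_mul]
    rw [Finset.sum_congr rfl fun ω hω => by rw [h ω hω],
      Finset.sum_eq_single_of_mem 0 hzero (by simp +contextual), paritySign_zero_right] at hleft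
    rw [eq_inv_mul_iff_mul_eq₀ (pow_ne_zero d two_ne_zero), ← hleft]
    simp
  · intro h ω hω
    rw [Finset.sum_congr rfl fun γ hγ => by rw [h γ hγ], ← Finset.sum_mul]
    by_cases hn : n = 0
    · subst hn
      simp only [zero_add, paritySign_comm _ ω, sum_paritySign]
      have hiff : (∀ i, Even (ω i)) ↔ ω = 0 := by
        simpa using even_add_iff_of_mem_binaryCube 0 hω hzero
      simp only [hiff]
      split_ifs <;> simp
    · simp [hn]

/-- The equivalence for an arbitrary finite family of finitely supported filters. -/
theorem sum_fourierSeries_mul_conj_eq_iff {d : ℕ} {ι : Type*} [Fintype ι]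
    (c : ι → (Fin d → ℤ) → ℂ) (hc : ∀ ℓ, (Function.support (c ℓ)).Finite) :
    (∀ (ξ : Fin d → ℝ), ∀ ω ∈ binaryCube d,
      ∑ ℓ, fourierSeries (c ℓ) ξ *
          (starRingEnd ℂ) (fourierSeries (c ℓ) (fun i => ξ i + Real.pi * (ω i : ℝ))) =
        (if ω = 0 then 1 else 0)) ↔
    ∀ γ ∈ binaryCube d, ∀ n : Fin d → ℤ,
      ∑ ℓ, cosetCorrelation (c ℓ) n γ = ((2 : ℂ) ^ d)⁻¹ * (if n = 0 then 1 else 0) := by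
  classical
  obtain ⟨T, hT⟩ : ∃ T : Finset (Fin d → ℤ), ∀ ℓ, Function.support (c ℓ) ⊆ T :=
    ⟨Finset.univ.biUnion fun ℓ => (hc ℓ).toFinset, fun ℓ k hk => by
      simpa using ⟨ℓ, hk⟩⟩
  let D : Finset (Fin d → ℤ) := (T ×ˢ T).image fun p => p.2 - p.1
  have hD : ∀ k ∈ T, ∀ m ∈ T, m - k ∈ D := fun k hk m hm =>
    Finset.mem_image.mpr ⟨(k, m), Finset.mem_product.mpr ⟨hk, hm⟩, rfl⟩
  let coeff (n ω : Fin d → ℤ) : ℂ :=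
    ∑ γ ∈ binaryCube d, paritySign (n + γ) ω * ∑ ℓ, cosetCorrelation (c ℓ) n γ
  have hexpand (N : Finset (Fin d → ℤ)) (hN : D ⊆ N) (h0 : 0 ∈ N) (ξ : Fin d → ℝ)
      (ω : Fin d → ℤ) :
      ∑ ℓ, fourierSeries (c ℓ) ξ *
          (starRingEnd ℂ) (fourierSeries (c ℓ) (fun i => ξ i + Real.pi * (ω i : ℝ))) -
        (if ω = 0 then 1 else 0) =
      ∑ n ∈ N, (coeff n ω - (if ω = 0 then 1 else 0) * (if n = 0 then 1 else 0)) *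
        expChar n (.ofAdd ξ) := by
    simp only [fun ℓ => fourierSeries_mul_conj_shift (hT ℓ)
      (fun k hk m hm => hN (hD k hk m hm)) ξ ω, sub_mul, Finset.sum_sub_distrib]
    congr 1
    · rw [Finset.sum_comm]
      refine Finset.sum_congr rfl fun n _ => ?_
      rw [← Finset.sum_mul, Finset.sum_comm]
      simp only [coeff, Finset.mul_sum]
    · rw [Finset.sum_eq_single_of_mem 0 h0 (by simp +contextual)]
      simp [expChar_apply]
  have hfreq : (∀ (ξ : Fin d → ℝ), ∀ ω ∈ binaryCube d,
      ∑ ℓ, fourierSeries (c ℓ) ξ *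
          (starRingEnd ℂ) (fourierSeries (c ℓ) (fun i => ξ i + Real.pi * (ω i : ℝ))) =
        (if ω = 0 then 1 else 0)) ↔
      ∀ n, ∀ ω ∈ binaryCube d,
        coeff n ω = (if ω = 0 then 1 else 0) * (if n = 0 then 1 else 0) := by
    constructor
    · intro h n ω hω
      have hN : D ⊆ insert n (insert 0 D) := fun x hx => by simp [hx]
      refine sub_eq_zero.mp (trigPolynomial_eq_zero (insert n (insert 0 D))
        (fun n => coeff n ω - (if ω = 0 then 1 else 0) * (if n = 0 then 1 else 0))
        (fun ξ => ?_) n (Finset.mem_insert_self _ _))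
      rw [← hexpand _ hN (by simp) ξ ω, sub_eq_zero]
      exact h ξ ω hω
    · intro h ξ ω hω
      rw [← sub_eq_zero, hexpand (insert 0 D) (Finset.subset_insert _ _) (by simp)]
      exact Finset.sum_eq_zero fun n _ => by rw [h n ω hω, sub_self, zero_mul]
  rw [hfreq, forall_congr' fun n => paritySign_transform_eq_iff n _]
  exact ⟨fun h γ hγ n => h n γ hγ, fun h n γ hγ => h γ hγ n⟩

/-- Equivalence of the frequency-domain and spatial-domain characterizations of a
`d`-dimensional dyadic tight framelet filter bank `{a; b_1, …, b_s}`. -/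
theorem tffb_frequency_iff_spatial (d s : ℕ) (a : (Fin d → ℤ) → ℂ)
    (b : Fin s → (Fin d → ℤ) → ℂ) (ha : (Function.support a).Finite)
    (hb : ∀ ℓ, (Function.support (b ℓ)).Finite) :
    (∀ (ξ : Fin d → ℝ) (ω : Fin d → ℤ), (∀ i, ω i = 0 ∨ ω i = 1) →
      fourierSeries a ξ *
          (starRingEnd ℂ) (fourierSeries a (fun i => ξ i + Real.pi * (ω i : ℝ))) +
        ∑ ℓ, fourierSeries (b ℓ) ξ *
          (starRingEnd ℂ) (fourierSeries (b ℓ) (fun i => ξ i + Real.pi * (ω i : ℝ))) =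
        (if ω = 0 then 1 else 0)) ↔
    (∀ γ : Fin d → ℤ, (∀ i, γ i = 0 ∨ γ i = 1) → ∀ n : Fin d → ℤ,
      (∑ᶠ k : Fin d → ℤ, a (fun i => γ i + 2 * k i) *
          (starRingEnd ℂ) (a (fun i => n i + γ i + 2 * k i))) +
        ∑ ℓ, ∑ᶠ k : Fin d → ℤ, b ℓ (fun i => γ i + 2 * k i) *
          (starRingEnd ℂ) (b ℓ (fun i => n i + γ i + 2 * k i)) =
        ((2 : ℂ) ^ d)⁻¹ * (if n = 0 then 1 else 0)) := by
  have h := sum_fourierSeries_mul_conj_eq_iff (fun o : Option (Fin s) => o.elim a b) (by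
    rintro (_ | ℓ)
    exacts [ha, hb ℓ])
  simpa only [Fintype.sum_option, Option.elim_none, Option.elim_some, mem_binaryCube,
    cosetCorrelation] using h
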